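/- Let 𝔤 carry an invariant inner product, i.e. ⟨[u,v],w⟩ + ⟨v,[u,w]⟩ = 0 for all u,v,w ∈ 𝔤 (corresponding to a bi-invariant Riemannian metric). Fix X ∈ 𝔤 with ‖X‖ < 1/2 such that ∇_v X = 0 for all v ∈ 𝔤. Let Y, U ∈ 𝔤 be orthonormal (⟨Y,Y⟩ = ⟨U,U⟩ = 1, ⟨Y,U⟩ = 0). Then, with R the curvature of the Koszul connection, the flag curvature K(P,Y) = g_Y(R(U,Y)Y, U) / (g_Y(Y,Y)·g_Y(U,U) − g_Y(Y,U)²) of the Matsumoto metric associated to X equals −(1 − ⟨Y,X⟩)² / (4(1 − ⟨Y,X⟩)(1 − 2⟨Y,X⟩) + 8⟨U,X⟩²) · { ⟨[[U,Y],Y],U⟩·(1 − ⟨Y,X⟩)(1 − 2⟨Y,X⟩) + 3⟨[[U,Y],Y],X⟩·⟨U,X⟩ }. -/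

import Mathlib

open scoped RealInnerProductSpace

/-- The Matsumoto metric `F(y) = ⟨y,y⟩ / (√⟨y,y⟩ − ⟨X,y⟩)` associated to the
vector `X` of an inner product space. -/
noncomputable def matsumotoF {V : Type*} [NormedAddCommGroup V] [InnerProductSpace ℝ V]
    (X y : V) : ℝ :=
  ⟪y, y⟫ / (Real.sqrt ⟪y, y⟫ - ⟪X, y⟫)

/-- The fundamental tensor of the Matsumoto metric:
`g_Y(U,W) = (1/2)·∂²/∂s∂t [F²(Y + sU + tW)]` at `s = t = 0`. -/
noncomputable def matsumotoG {V : Type*} [NormedAddCommGroup V] [InnerProductSpace ℝ V]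
    (X Y U W : V) : ℝ :=
  (1 / 2) * deriv (fun s : ℝ =>
    deriv (fun t : ℝ => (matsumotoF X (Y + s • U + t • W)) ^ 2) 0) 0

/-- The curvature tensor `R(u,v)w = ∇_u(∇_v w) − ∇_v(∇_u w) − ∇_{[u,v]} w`
of a connection `nabla` on a Lie algebra. -/
def curvature {V : Type*} [LieRing V] (nabla : V → V → V) (u v w : V) : V :=
  nabla u (nabla v w) - nabla v (nabla u w) - nabla ⁅u, v⁆ w

/-- Directional derivative of `F²` for the Matsumoto metric, along a line through `y`. -/
lemma hasDerivAt_matsumotoF_sq {V : Type*} [NormedAddCommGroup V] [InnerProductSpace ℝ V]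
    {X y : V} (W : V) (hy : 0 < ⟪y, y⟫) (hD : Real.sqrt ⟪y, y⟫ - ⟪X, y⟫ ≠ 0) :
    HasDerivAt (fun t : ℝ => (matsumotoF X (y + t • W)) ^ 2)
      (4 * ⟪y, y⟫ * ⟪y, W⟫ / (Real.sqrt ⟪y, y⟫ - ⟪X, y⟫) ^ 2
        - 2 * ⟪y, y⟫ * Real.sqrt ⟪y, y⟫ * (⟪y, W⟫ - ⟪X, W⟫ * Real.sqrt ⟪y, y⟫)
          / (Real.sqrt ⟪y, y⟫ - ⟪X, y⟫) ^ 3) 0 := by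
  have hline : HasDerivAt (fun t : ℝ => y + t • W) W 0 := by
    simpa using ((hasDerivAt_id (0 : ℝ)).smul_const W).const_add y
  have hN : HasDerivAt (fun t : ℝ => ⟪y + t • W, y + t • W⟫) (2 * ⟪y, W⟫) 0 := by
    have h := hline.inner ℝ hline
    simp only [zero_smul, add_zero, real_inner_comm y W] at h
    rwa [← two_mul] at h
  have hL : HasDerivAt (fun t : ℝ => ⟪X, y + t • W⟫) ⟪X, W⟫ 0 := by
    simpa using (hasDerivAt_const (0 : ℝ) X).inner ℝ hline
  have hr := hN.sqrt (by simpa using hy.ne')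
  have hF := (hN.div (hr.sub hL) (by simpa using hD)).pow 2
  have hsq : Real.sqrt ⟪y, y⟫ ^ 2 = ⟪y, y⟫ := Real.sq_sqrt hy.le
  have hr0 : Real.sqrt ⟪y, y⟫ ≠ 0 := (Real.sqrt_pos.2 hy).ne'
  refine hF.congr_deriv ?_
  simp only [Pi.div_apply, Pi.sub_apply, zero_smul, add_zero, Nat.reduceSub, pow_one, Nat.cast_ofNat]
  generalize Real.sqrt ⟪y, y⟫ - ⟪X, y⟫ = D at *
  generalize Real.sqrt ⟪y, y⟫ = r at *
  rw [← hsq]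
  field_simp
  ring

/-- The fundamental tensor of the Matsumoto metric at a unit vector. -/
lemma matsumotoG_eq {V : Type*} [NormedAddCommGroup V] [InnerProductSpace ℝ V]
    {X Y : V} (U W : V) (hY : ⟪Y, Y⟫ = 1) (hD : 1 - ⟪Y, X⟫ ≠ 0) :
    matsumotoG X Y U W =
      (4 * ⟪Y, U⟫ * ⟪Y, W⟫ + 2 * ⟪U, W⟫) / (1 - ⟪Y, X⟫) ^ 2
        - 4 * ⟪Y, W⟫ * (⟪Y, U⟫ - ⟪U, X⟫) / (1 - ⟪Y, X⟫) ^ 3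
        - (3 * ⟪Y, U⟫ * (⟪Y, W⟫ - ⟪W, X⟫) + ⟪U, W⟫ - ⟪W, X⟫ * ⟪Y, U⟫) / (1 - ⟪Y, X⟫) ^ 3
        + 3 * (⟪Y, W⟫ - ⟪W, X⟫) * (⟪Y, U⟫ - ⟪U, X⟫) / (1 - ⟪Y, X⟫) ^ 4 := by
  have hY' : ‖Y‖ = 1 := by rw [norm_eq_sqrt_real_inner, hY, Real.sqrt_one]
  have hline : HasDerivAt (fun s : ℝ => Y + s • U) U 0 := by
    simpa using ((hasDerivAt_id (0 : ℝ)).smul_const U).const_add Y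
  have hN : HasDerivAt (fun s : ℝ => ⟪Y + s • U, Y + s • U⟫) (2 * ⟪Y, U⟫) 0 := by
    have h := hline.inner ℝ hline
    simp only [zero_smul, add_zero, real_inner_comm Y U] at h
    rwa [← two_mul] at h
  have hL : HasDerivAt (fun s : ℝ => ⟪X, Y + s • U⟫) ⟪X, U⟫ 0 := by
    simpa using (hasDerivAt_const (0 : ℝ) X).inner ℝ hline
  have hm : HasDerivAt (fun s : ℝ => ⟪Y + s • U, W⟫) ⟪U, W⟫ 0 := by
    simpa using hline.inner ℝ (hasDerivAt_const (0 : ℝ) W)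
  have hr := hN.sqrt (by rw [zero_smul, add_zero, hY]; exact one_ne_zero)
  have hDen := hr.sub hL
  have hD' : 1 - ⟪X, Y⟫ ≠ 0 := by rwa [real_inner_comm]
  have hpos := (hN.continuousAt.eventually_const_lt (u := 0)
    (by simp only [zero_smul, add_zero, hY, one_pos])).and
    (hDen.continuousAt.eventually_ne (y := 0) (by simpa [hY'] using hD'))
  have hder := (((hN.const_mul 4).mul hm).div (hDen.pow 2) (by simpa [hY'] using hD')).sub
    ((((hN.const_mul 2).mul hr).mul (hm.sub (hr.const_mul ⟪X, W⟫))).div (hDen.pow 3)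
      (by simpa [hY'] using hD'))
  rw [matsumotoG, (hder.congr_of_eventuallyEq
    (hpos.mono fun s hs => (hasDerivAt_matsumotoF_sq W hs.1 hs.2).deriv)).deriv]
  simp only [Pi.sub_apply, Pi.mul_apply, Pi.pow_apply, zero_smul, add_zero, hY, Real.sqrt_one,
    real_inner_comm X, Nat.reduceSub, pow_one, Nat.cast_ofNat]
  generalize 1 - ⟪X, Y⟫ = D at *
  field_simp
  ring

/-- A map with a formal adjoint is additive and homogeneous. -/
lemma map_add_smul_of_inner_adjoint {V : Type*} [NormedAddCommGroup V] [InnerProductSpace ℝ V]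
    {f g : V → V} (h : ∀ v w, ⟪f v, w⟫ = ⟪v, g w⟫) (a b : V) (r : ℝ) :
    f (a + r • b) = f a + r • f b := by
  refine ext_inner_right ℝ fun w => ?_
  simp only [inner_add_left, real_inner_smul_left, h]

/-- Flag curvature operator of the Koszul connection of an invariant bracket `B`. The subtraction
`sub` with respect to which `B` is biadditive need not be that of `V`. -/
lemma koszul_curvature_of_invariant {V : Type*} [NormedAddCommGroup V] [InnerProductSpace ℝ V]
    {B sub nabla : V → V → V} {z : V}
    (hself : ∀ a, B a a = z)
    (hskew : ∀ a b, sub z (B a b) = B b a)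
    (hsub_zero : ∀ a, sub a z = a)
    (hsub_right : ∀ a b c, B a (sub b c) = sub (B a b) (B a c))
    (hinv : ∀ u v w : V, ⟪B u v, w⟫ + ⟪v, B u w⟫ = 0)
    (hK : ∀ u v w : V, 2 * ⟪nabla u v, w⟫ = ⟪B u v, w⟫ - ⟪B v w, u⟫ + ⟪B w u, v⟫) :
    z = 0 ∧ (∀ u v, nabla u v = (1 / 2 : ℝ) • B u v) ∧
      ∀ U Y, sub (sub (nabla U (nabla Y Y)) (nabla Y (nabla U Y))) (nabla (B U Y) Y)
        = (-(1 / 4) : ℝ) • B (B U Y) Y := by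
  have hright : ∀ u a b (r : ℝ), B u (a + r • b) = B u a + r • B u b := fun u =>
    map_add_smul_of_inner_adjoint (g := fun w => -B u w) fun v w => by
      rw [inner_neg_right]; linarith [hinv u v w]
  have hleft : ∀ u a b (r : ℝ), B (a + r • b) u = B a u + r • B b u := by
    intro u a b r
    refine ext_inner_right ℝ fun v => ?_
    have h₁ := hK u v (a + r • b)
    have h₂ := hK u v a
    have h₃ := hK u v b
    simp only [hright, inner_add_left, inner_add_right, real_inner_smul_left,
      real_inner_smul_right] at h₁ ⊢
    linear_combination h₂ - h₁ + r * h₃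
  have hzero_right : ∀ u, B u 0 = 0 := fun u => by
    simpa using hright u 0 0 1
  have hz : z = 0 := by rw [← hself 0, hzero_right]
  subst hz
  have hsmul_right : ∀ u a (r : ℝ), B u (r • a) = r • B u a := fun u a r => by
    simpa [hzero_right] using hright u 0 a r
  have hzero_left : ∀ u, B 0 u = 0 := fun u => by
    simpa using hleft u 0 0 1
  have hsmul_left : ∀ u a (r : ℝ), B (r • a) u = r • B a u := fun u a r => by
    simpa [hzero_left] using hleft u 0 a r
  have hanti : ∀ a b, B a b = -B b a := fun a b => by
    have h := hself (a + (1 : ℝ) • b)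
    rw [hleft, hright, hright, hself, hself] at h
    simp only [one_smul, zero_add, add_zero] at h
    exact eq_neg_of_add_eq_zero_left h
  have hnabla : ∀ u v, nabla u v = (1 / 2 : ℝ) • B u v := by
    intro u v
    refine ext_inner_right ℝ fun w => ?_
    have h₁ := hK u v w
    have h₂ := hinv v w u
    have h₃ := hinv u w v
    rw [hanti w u, inner_neg_left] at h₁
    rw [hanti v u, inner_neg_right, real_inner_comm (B u v) w] at h₂
    rw [real_inner_comm (B u v) w] at h₃
    rw [real_inner_smul_left]
    linarith
  refine ⟨rfl, hnabla, fun U Y => ?_⟩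
  -- the interchange law for the two additions, evaluated on multiples of a single bracket
  have hsub_smul : ∀ a c (r : ℝ), sub (B a c) (r • B a c) = B a c - r • B a c := by
    intro a c r
    have h₁ := hsub_right (a + r • c) c (-a)
    have h₂ := hleft (sub c (-a)) a c r
    have hna : ∀ e, B e (-a) = B a e := fun e => by
      rw [← neg_one_smul ℝ a, hsmul_right, neg_one_smul, ← hanti]
    rw [h₂, hsub_right, hsub_right, hleft, hleft, hself, hna, hna, hself, hsub_zero, hskew] at h₁
    simp only [smul_zero, add_zero, zero_add] at h₁
    rw [← h₁, hanti c a, smul_neg, sub_eq_add_neg]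
  simp only [hnabla, hself, smul_zero, hzero_right, hsmul_right, smul_smul]
  rw [← hsmul_right, hskew, hsmul_left]
  have h := hsub_smul ((1 / 4 : ℝ) • B U Y) Y 2
  rw [hsmul_left, smul_smul] at h
  norm_num at h ⊢
  rw [h]
  module

theorem matsumoto_flag_curvature_biinvariant
    {V : Type*} [NormedAddCommGroup V] [InnerProductSpace ℝ V] [FiniteDimensional ℝ V]
    [LieRing V] [LieAlgebra ℝ V]
    -- the inner product is invariant (corresponding to a bi-invariant metric)
    (hinv : ∀ u v w : V, ⟪⁅u, v⁆, w⟫ + ⟪v, ⁅u, w⁆⟫ = 0)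
    -- the Levi-Civita (Koszul) connection
    (nabla : V → V → V)
    (hK : ∀ u v w : V, 2 * ⟪nabla u v, w⟫ = ⟪⁅u, v⁆, w⟫ - ⟪⁅v, w⁆, u⟫ + ⟪⁅w, u⁆, v⟫)
    (X : V) (hXnorm : ‖X‖ < 1 / 2) (hXpar : ∀ v : V, nabla v X = 0)
    (Y U : V) (hY : ⟪Y, Y⟫ = 1) (hU : ⟪U, U⟫ = 1) (hYU : ⟪Y, U⟫ = 0) :
    matsumotoG X Y (curvature nabla U Y Y) U /
        (matsumotoG X Y Y Y * matsumotoG X Y U U - matsumotoG X Y Y U ^ 2) =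
      -(1 - ⟪Y, X⟫) ^ 2 /
          (4 * (1 - ⟪Y, X⟫) * (1 - 2 * ⟪Y, X⟫) + 8 * ⟪U, X⟫ ^ 2) *
        (⟪⁅⁅U, Y⁆, Y⁆, U⟫ * (1 - ⟪Y, X⟫) * (1 - 2 * ⟪Y, X⟫)
          + 3 * ⟪⁅⁅U, Y⁆, Y⁆, X⟫ * ⟪U, X⟫) := by
  obtain ⟨hz, hnabla, hcurv⟩ := koszul_curvature_of_invariant (B := fun a b => ⁅a, b⁆)
    (sub := fun a b => a - b) (nabla := nabla) (fun a => lie_self a)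
    (fun a b => (zero_sub _).trans (lie_skew b a)) (fun a => sub_zero a)
    (fun a b c => lie_sub a b c) hinv hK
  have hX : ∀ v w : V, ⟪⁅v, w⁆, X⟫ = 0 := by
    intro v w
    have h₁ := hXpar v
    rw [hz, hnabla] at h₁
    have h₂ := congrArg (fun a => ⟪w, a⟫) h₁
    simp only [real_inner_smul_right, inner_zero_right] at h₂
    linarith [hinv v w X]
  have hZX : ⟪⁅⁅U, Y⁆, Y⁆, X⟫ = 0 := hX _ _
  have hZY : ⟪Y, ⁅⁅U, Y⁆, Y⁆⟫ = 0 := by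
    have h := hinv ⁅U, Y⁆ Y Y
    rw [real_inner_comm] at h
    linarith
  have hYX : ⟪Y, X⟫ < 1 / 2 := by
    have h := real_inner_le_norm Y X
    have hY' : ‖Y‖ = 1 := by rw [norm_eq_sqrt_real_inner, hY, Real.sqrt_one]
    rw [hY', one_mul] at h
    linarith
  have hD : 1 - ⟪Y, X⟫ ≠ 0 := by linarith
  have hE : 0 < 1 - 2 * ⟪Y, X⟫ := by linarith
  have hden : (1 - ⟪Y, X⟫) * (1 - 2 * ⟪Y, X⟫) + 2 * ⟪U, X⟫ ^ 2 ≠ 0 := by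
    have : 0 < 1 - ⟪Y, X⟫ := by linarith
    positivity
  have hR : curvature nabla U Y Y = _ := hcurv U Y
  rw [hR]
  simp only [matsumotoG_eq _ _ hY hD, real_inner_smul_left, real_inner_smul_right, hZX, hZY, hY, hU,
    hYU]
  generalize ⟪⁅⁅U, Y⁆, Y⁆, U⟫ = k
  generalize ⟪Y, X⟫ = b at *
  generalize ⟪U, X⟫ = c at *
  have hfrac : ∀ N M : ℝ, M = ((1 - b) * (1 - 2 * b) + 2 * c ^ 2) / (1 - b) ^ 6 →
      N = -(1 / 4) * k * (1 - 2 * b) / (1 - b) ^ 3 →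
      N / M = -(1 - b) ^ 2 / (4 * (1 - b) * (1 - 2 * b) + 8 * c ^ 2) *
        (k * (1 - b) * (1 - 2 * b) + 3 * 0 * c) := by
    rintro N M rfl rfl
    rw [show 4 * (1 - b) * (1 - 2 * b) + 8 * c ^ 2 = 4 * ((1 - b) * (1 - 2 * b) + 2 * c ^ 2) by
      ring]
    generalize (1 - b) * (1 - 2 * b) + 2 * c ^ 2 = d at *
    generalize 1 - b = D at *
    field_simp
    ring
  apply hfrac
  · field_simp
    ring
  · field_simp
    ring
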